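/- Let I ⊆ {1,…,m} and J ⊆ {1,…,n} be nonempty with A_{i,:} ≠ 0 for all i ∈ I and B_{:,j} ≠ 0 for all j ∈ J, and assume C_{ij} = A_{i,:} X* B_{:,j} for all i ∈ I, j ∈ J. Let u_i (i ∈ I), v_j (j ∈ J) satisfy 0 < u_min ≤ u_i ≤ u_max and 0 < v_min ≤ v_j ≤ v_max, let Ã_{I,:} have rows A_{i,:}/‖A_{i,:}‖₂ (i ∈ I) and B̃_{:,J} have columns B_{:,j}/‖B_{:,j}‖₂ (j ∈ J), and let γ₁, γ₂ ≥ 0 satisfy ‖Ã_{I,:} x‖₂ ≤ γ₁ ‖x‖₂ for all x and ‖B̃_{:,J} c‖₂ ≤ γ₂ ‖c‖₂ for all c. Then for any stepsize α ≥ 0, the GRABK update X' = X + α ∑_{i ∈ I, j ∈ J} u_i v_j (A_{i,:})ᵀ (C_{ij} − A_{i,:} X B_{:,j}) (B_{:,j})ᵀ / (‖A_{i,:}‖₂² ‖B_{:,j}‖₂²) satisfies ‖X' − X*‖_F² ≤ ‖X − X*‖_F² − (2 α u_min v_min − α² u_max² v_max² γ₁² γ₂²) ‖Ã_{I,:} (X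 − X*) B̃_{:,J}‖_F². -/

import Mathlib

open Matrix

noncomputable def vecNormSq {α : Type*} [Fintype α] (x : α → ℝ) : ℝ := ∑ i, (x i) ^ 2

noncomputable def vecNorm {α : Type*} [Fintype α] (x : α → ℝ) : ℝ := Real.sqrt (vecNormSq x)

noncomputable def frobNormSq {α β : Type*} [Fintype α] [Fintype β] (M : Matrix α β ℝ) : ℝ :=
  ∑ i, ∑ j, (M i j) ^ 2

noncomputable def frobNorm {α β : Type*} [Fintype α] [Fintype β] (M : Matrix α β ℝ) : ℝ :=
  Real.sqrt (frobNormSq M)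

noncomputable def frobInner {α β : Type*} [Fintype α] [Fintype β] (U V : Matrix α β ℝ) : ℝ :=
  ∑ i, ∑ j, U i j * V i j

def IsMPInv {α β : Type*} [Fintype α] [Fintype β] (M : Matrix α β ℝ) (P : Matrix β α ℝ) : Prop :=
  M * P * M = M ∧ P * M * P = P ∧ (M * P)ᵀ = M * P ∧ (P * M)ᵀ = P * M

def rowSub {m p : ℕ} (A : Matrix (Fin m) (Fin p) ℝ) (I : Finset (Fin m)) :
    Matrix {i // i ∈ I} (Fin p) ℝ := A.submatrix Subtype.val id

def colSub {q n : ℕ} (B : Matrix (Fin q) (Fin n) ℝ) (J : Finset (Fin n)) :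
    Matrix (Fin q) {j // j ∈ J} ℝ := B.submatrix id Subtype.val

def subMat {m n : ℕ} (C : Matrix (Fin m) (Fin n) ℝ) (I : Finset (Fin m)) (J : Finset (Fin n)) :
    Matrix {i // i ∈ I} {j // j ∈ J} ℝ := C.submatrix Subtype.val Subtype.val

noncomputable def bilin {m p q n : ℕ} (A : Matrix (Fin m) (Fin p) ℝ) (B : Matrix (Fin q) (Fin n) ℝ)
    (X : Matrix (Fin p) (Fin q) ℝ) (i : Fin m) (j : Fin n) : ℝ :=
  ∑ a, ∑ b, A i a * X a b * B b j

def rank1 {m p q n : ℕ} (A : Matrix (Fin m) (Fin p) ℝ) (B : Matrix (Fin q) (Fin n) ℝ)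
    (i : Fin m) (j : Fin n) (s : ℝ) : Matrix (Fin p) (Fin q) ℝ :=
  Matrix.of fun a b => A i a * s * B b j

noncomputable def rowSubNorm {m p : ℕ} (A : Matrix (Fin m) (Fin p) ℝ) (I : Finset (Fin m)) :
    Matrix {i // i ∈ I} (Fin p) ℝ := Matrix.of fun i a => A i.val a / vecNorm (A i.val)

noncomputable def colSubNorm {q n : ℕ} (B : Matrix (Fin q) (Fin n) ℝ) (J : Finset (Fin n)) :
    Matrix (Fin q) {j // j ∈ J} ℝ :=
  Matrix.of fun b j => B b j.val / vecNorm (fun b' => B b' j.val)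


lemma aux_sq {α β : Type*} [Fintype α] [Fintype β] (P : Matrix α β ℝ) (g : ℝ)
    (h : ∀ x : β → ℝ, vecNorm (P.mulVec x) ≤ g * vecNorm x) (x : β → ℝ) :
    vecNormSq (P.mulVec x) ≤ g ^ 2 * vecNormSq x := by
  have h1 := h x
  have e1 : vecNorm (P.mulVec x) ^ 2 = vecNormSq (P.mulVec x) :=
    Real.sq_sqrt (Finset.sum_nonneg fun _ _ => sq_nonneg _)
  have e2 : vecNorm x ^ 2 = vecNormSq x :=
    Real.sq_sqrt (Finset.sum_nonneg fun _ _ => sq_nonneg _)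
  rw [← e1, ← e2, ← mul_pow]
  exact pow_le_pow_left₀ (Real.sqrt_nonneg _) h1 2

lemma vecNormSq_eq {α : Type*} [Fintype α] (x : α → ℝ) : vecNormSq x = x ⬝ᵥ x := by
  simp [vecNormSq, dotProduct, sq]

lemma aux_transpose {α β : Type*} [Fintype α] [Fintype β] (P : Matrix α β ℝ) (g : ℝ)
    (h : ∀ x : β → ℝ, vecNormSq (P.mulVec x) ≤ g ^ 2 * vecNormSq x) (y : α → ℝ) :
    vecNormSq (Pᵀ.mulVec y) ≤ g ^ 2 * vecNormSq y := by
  have e : vecNormSq (Pᵀ.mulVec y) = y ⬝ᵥ P.mulVec (Pᵀ.mulVec y) := by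
    rw [vecNormSq_eq, Matrix.dotProduct_mulVec y, Matrix.mulVec_transpose]
  have cs : (y ⬝ᵥ P.mulVec (Pᵀ.mulVec y)) ^ 2
      ≤ vecNormSq y * vecNormSq (P.mulVec (Pᵀ.mulVec y)) :=
    Finset.sum_mul_sq_le_sq_mul_sq _ _ _
  rw [← e] at cs
  have h2 := h (Pᵀ.mulVec y)
  have n1 : 0 ≤ vecNormSq y := Finset.sum_nonneg fun _ _ => sq_nonneg _
  have n2 : 0 ≤ vecNormSq (Pᵀ.mulVec y) := Finset.sum_nonneg fun _ _ => sq_nonneg _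
  generalize vecNormSq (Pᵀ.mulVec y) = s at *
  have h3 := cs.trans (mul_le_mul_of_nonneg_left h2 n1)
  rcases n2.eq_or_lt with h0 | h0
  · rw [← h0]; positivity
  · refine le_of_mul_le_mul_right ?_ h0
    nlinarith

lemma frob_transpose {α β : Type*} [Fintype α] [Fintype β] (M : Matrix α β ℝ) :
    frobNormSq Mᵀ = frobNormSq M := by
  unfold frobNormSq
  exact Finset.sum_comm

lemma aux_frob {α β δ : Type*} [Fintype α] [Fintype β] [Fintype δ] (P : Matrix α β ℝ) (g : ℝ)
    (h : ∀ x : β → ℝ, vecNormSq (P.mulVec x) ≤ g ^ 2 * vecNormSq x) (Y : Matrix β δ ℝ) :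
    frobNormSq (P * Y) ≤ g ^ 2 * frobNormSq Y := by
  rw [← frob_transpose, ← frob_transpose Y]
  unfold frobNormSq
  rw [Finset.mul_sum]
  exact Finset.sum_le_sum fun k _ => h (fun b => Y b k)

lemma frobInner_eq {α β : Type*} [Fintype α] [Fintype β] (U V : Matrix α β ℝ) :
    frobInner U V = (U * Vᵀ).trace := by
  simp [frobInner, Matrix.trace, Matrix.mul_apply]

lemma aux_adj {α β γ δ : Type*} [Fintype α] [Fintype β] [Fintype γ] [Fintype δ]
    (P : Matrix α β ℝ) (D : Matrix β γ ℝ) (Q : Matrix γ δ ℝ) (W : Matrix α δ ℝ) :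
    frobInner D (Pᵀ * W * Qᵀ) = frobInner (P * D * Q) W := by
  rw [frobInner_eq, frobInner_eq]
  simp only [Matrix.transpose_mul, Matrix.transpose_transpose]
  rw [← Matrix.mul_assoc, ← Matrix.mul_assoc, Matrix.trace_mul_comm]
  simp only [Matrix.mul_assoc]

lemma frob_expand {α β : Type*} [Fintype α] [Fintype β] (D G : Matrix α β ℝ) (t : ℝ) :
    frobNormSq (D - t • G) = frobNormSq D - 2 * t * frobInner D G + t ^ 2 * frobNormSq G := by
  unfold frobNormSq frobInner
  simp only [Finset.mul_sum, ← Finset.sum_sub_distrib, ← Finset.sum_add_distrib]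
  refine Finset.sum_congr rfl fun i _ => Finset.sum_congr rfl fun j _ => ?_
  simp only [Matrix.sub_apply, Matrix.smul_apply, smul_eq_mul]
  ring

lemma bilin_sub {m p q n : ℕ} (A : Matrix (Fin m) (Fin p) ℝ) (B : Matrix (Fin q) (Fin n) ℝ)
    (X Y : Matrix (Fin p) (Fin q) ℝ) (i : Fin m) (j : Fin n) :
    bilin A B X i j - bilin A B Y i j = bilin A B (X - Y) i j := by
  unfold bilin
  simp only [← Finset.sum_sub_distrib, Matrix.sub_apply]
  refine Finset.sum_congr rfl fun i _ => Finset.sum_congr rfl fun j _ => ?_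
  ring

lemma aux_R {m p q n : ℕ} (A : Matrix (Fin m) (Fin p) ℝ) (B : Matrix (Fin q) (Fin n) ℝ)
    (D : Matrix (Fin p) (Fin q) ℝ) (I : Finset (Fin m)) (J : Finset (Fin n))
    (i : {i // i ∈ I}) (j : {j // j ∈ J}) :
    (rowSubNorm A I * D * colSubNorm B J) i j
      = bilin A B D i j / (vecNorm (A i.val) * vecNorm (fun b => B b j.val)) := by
  unfold bilin
  simp only [Matrix.mul_apply, rowSubNorm, colSubNorm, Matrix.of_apply, Finset.sum_mul,
    Finset.sum_div]
  rw [Finset.sum_comm]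
  refine Finset.sum_congr rfl fun a _ => Finset.sum_congr rfl fun b _ => ?_
  simp only [div_eq_mul_inv, mul_inv]
  ring

lemma aux_G {m p q n : ℕ} (A : Matrix (Fin m) (Fin p) ℝ) (B : Matrix (Fin q) (Fin n) ℝ)
    (Xs X : Matrix (Fin p) (Fin q) ℝ) (C : Matrix (Fin m) (Fin n) ℝ)
    (I : Finset (Fin m)) (J : Finset (Fin n))
    (hCons : ∀ i ∈ I, ∀ j ∈ J, C i j = bilin A B Xs i j)
    (u : Fin m → ℝ) (v : Fin n → ℝ) :
    ∑ i ∈ I, ∑ j ∈ J, (u i * v j / (vecNormSq (A i) * vecNormSq (fun b => B b j))) •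
            rank1 A B i j (C i j - bilin A B X i j)
      = - ((rowSubNorm A I)ᵀ * (Matrix.of fun (i : {i // i ∈ I}) (j : {j // j ∈ J}) =>
          u i * v j * (rowSubNorm A I * (X - Xs) * colSubNorm B J) i j) * (colSubNorm B J)ᵀ) := by
  have e : ∀ {k : ℕ} (x : Fin k → ℝ), vecNormSq x = vecNorm x * vecNorm x := fun x =>
    (Real.mul_self_sqrt (Finset.sum_nonneg fun _ _ => sq_nonneg _)).symm
  ext a b
  rw [Matrix.neg_apply, Matrix.mul_apply]
  simp only [Matrix.mul_apply (M := (rowSubNorm A I)ᵀ), Matrix.sum_apply, Finset.sum_mul]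
  rw [Finset.sum_comm, ← Finset.sum_neg_distrib, ← Finset.sum_attach J]
  refine Finset.sum_congr rfl fun j _ => ?_
  rw [← Finset.sum_neg_distrib, ← Finset.sum_attach I]
  refine Finset.sum_congr rfl fun i _ => ?_
  rw [hCons i i.2 j j.2, bilin_sub, Matrix.of_apply, aux_R, ← neg_sub X Xs]
  have hb : bilin A B (-(X - Xs)) i j = - bilin A B (X - Xs) i j := by
    rw [neg_sub, ← bilin_sub, ← bilin_sub, neg_sub]
  rw [hb]
  simp only [Matrix.smul_apply, rank1, Matrix.of_apply, smul_eq_mul, Matrix.transpose_apply,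
    rowSubNorm, colSubNorm, e, div_eq_mul_inv, mul_inv]
  ring

/-- key one-step deterministic estimate for the GRABK method with constant
stepsize `α ≥ 0`. -/
theorem grabk_one_step_decrease {m p q n : ℕ}
    (A : Matrix (Fin m) (Fin p) ℝ) (B : Matrix (Fin q) (Fin n) ℝ)
    (Xs X : Matrix (Fin p) (Fin q) ℝ) (C : Matrix (Fin m) (Fin n) ℝ)
    (I : Finset (Fin m)) (J : Finset (Fin n)) (hIne : I.Nonempty) (hJne : J.Nonempty)
    (hAnz : ∀ i ∈ I, A i ≠ 0) (hBnz : ∀ j ∈ J, (fun b => B b j) ≠ 0)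
    (hCons : ∀ i ∈ I, ∀ j ∈ J, C i j = bilin A B Xs i j)
    (u : Fin m → ℝ) (v : Fin n → ℝ) (umin umax vmin vmax : ℝ)
    (humin : 0 < umin) (hvmin : 0 < vmin)
    (hu : ∀ i ∈ I, umin ≤ u i ∧ u i ≤ umax) (hv : ∀ j ∈ J, vmin ≤ v j ∧ v j ≤ vmax)
    (γ₁ γ₂ : ℝ) (hγ₁ : 0 ≤ γ₁) (hγ₂ : 0 ≤ γ₂)
    (hγA : ∀ x : Fin p → ℝ, vecNorm ((rowSubNorm A I).mulVec x) ≤ γ₁ * vecNorm x)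
    (hγB : ∀ c : {j // j ∈ J} → ℝ, vecNorm ((colSubNorm B J).mulVec c) ≤ γ₂ * vecNorm c)
    (α : ℝ) (hα : 0 ≤ α) :
    frobNormSq ((X + α • ∑ i ∈ I, ∑ j ∈ J,
          (u i * v j / (vecNormSq (A i) * vecNormSq (fun b => B b j))) •
            rank1 A B i j (C i j - bilin A B X i j)) - Xs)
      ≤ frobNormSq (X - Xs)
        - (2 * α * umin * vmin - α ^ 2 * umax ^ 2 * vmax ^ 2 * γ₁ ^ 2 * γ₂ ^ 2) *
            frobNormSq (rowSubNorm A I * (X - Xs) * colSubNorm B J) := by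
  have hG := aux_G A B Xs X C I J hCons u v
  rw [hG]
  set R := rowSubNorm A I * (X - Xs) * colSubNorm B J with hR
  set W : Matrix {i // i ∈ I} {j // j ∈ J} ℝ := Matrix.of fun i j => u i * v j * R i j with hW
  have e1 : X + α • -((rowSubNorm A I)ᵀ * W * (colSubNorm B J)ᵀ) - Xs
      = (X - Xs) - α • ((rowSubNorm A I)ᵀ * W * (colSubNorm B J)ᵀ) := by
    rw [smul_neg]; abel
  rw [e1, frob_expand, aux_adj, ← hR]
  have b1 : umin * vmin * frobNormSq R ≤ frobInner R W := by
    unfold frobNormSq frobInner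
    simp only [Finset.mul_sum]
    refine Finset.sum_le_sum fun i _ => Finset.sum_le_sum fun j _ => ?_
    have h1 : umin * vmin ≤ u i * v j :=
      mul_le_mul (hu i i.2).1 (hv j j.2).1 hvmin.le (humin.le.trans (hu i i.2).1)
    have h2 := mul_le_mul_of_nonneg_right h1 (sq_nonneg (R i j))
    simp only [hW, Matrix.of_apply]
    linarith
  have b2 : frobNormSq W ≤ umax ^ 2 * vmax ^ 2 * frobNormSq R := by
    unfold frobNormSq
    simp only [Finset.mul_sum]
    refine Finset.sum_le_sum fun i _ => Finset.sum_le_sum fun j _ => ?_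
    have hu0 := humin.le.trans (hu i i.2).1
    have hv0 := hvmin.le.trans (hv j j.2).1
    simp only [hW, Matrix.of_apply, mul_pow]
    have := (hu i i.2).2
    have := (hv j j.2).2
    gcongr
  have b3 : frobNormSq ((rowSubNorm A I)ᵀ * W * (colSubNorm B J)ᵀ)
      ≤ γ₁ ^ 2 * (γ₂ ^ 2 * frobNormSq W) := by
    rw [Matrix.mul_assoc]
    refine (aux_frob _ γ₁ (aux_transpose _ γ₁ (aux_sq _ γ₁ hγA)) _).trans ?_
    refine mul_le_mul_of_nonneg_left ?_ (sq_nonneg _)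
    rw [← frob_transpose, ← frob_transpose W, Matrix.transpose_mul, Matrix.transpose_transpose]
    exact aux_frob _ γ₂ (aux_sq _ γ₂ hγB) _
  have b4 : frobNormSq ((rowSubNorm A I)ᵀ * W * (colSubNorm B J)ᵀ)
      ≤ γ₁ ^ 2 * (γ₂ ^ 2 * (umax ^ 2 * vmax ^ 2 * frobNormSq R)) :=
    b3.trans (by gcongr)
  have c1 := mul_le_mul_of_nonneg_left b1 (by positivity : 0 ≤ 2 * α)
  have c2 := mul_le_mul_of_nonneg_left b4 (sq_nonneg α)
  linarith
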